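/- Let V = [N], let 0 < k < N, and let C = {S ⊆ V : |S| = k}. Let F : 2^V → ℝ, β ≥ 0, and let π_C(S) = exp(βF(S))/Z_C for S ∈ C, where Z_C = Σ_{S∈C} exp(βF(S)). Let ζ_F = max_{S,T∈C} |F(S) + F(T) − F(S∩T) − F(S∪T)|. Consider the lazy Gibbs exchange chain on C: from state S, with probability 1/2 do nothing; otherwise choose s ∈ S and t ∈ V\S independently and uniformly at random and move to T = S∪{t}\{s} with probability π_C(T)/(π_C(S) + π_C(T)), staying at S otherwise. Then for every starting state X0 ∈ C and every ε ∈ (0,1), the mixing time satisfies τ_{X0}(ε) ≤ 4k(N−k)·exp(2βζ_F)·(log π_C(X0)^{-1} + log ε^{-1}). -/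

import Mathlib

open Finset
open scoped Classical

/-- Total variation distance between the `t`-step distribution of the chain with
transition matrix `P` started at `x0` and the distribution `μ`. -/
noncomputable def tvDist {Ω : Type*} [Fintype Ω] [DecidableEq Ω]
    (P : Matrix Ω Ω ℝ) (μ : Ω → ℝ) (x0 : Ω) (t : ℕ) : ℝ :=
  (1 / 2) * ∑ y, |(P ^ t) x0 y - μ y|

/-- Mixing time `τ_{x0}(ε)`. -/
noncomputable def mixingTime {Ω : Type*} [Fintype Ω] [DecidableEq Ω]
    (P : Matrix Ω Ω ℝ) (μ : Ω → ℝ) (x0 : Ω) (ε : ℝ) : ℕ :=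
  sInf {t : ℕ | ∀ t' ≥ t, tvDist P μ x0 t' ≤ ε}

section core
open scoped Pointwise

lemma swap_inter_aux {α : Type*} [DecidableEq α] (X Y : Finset α) (d e : α)
    (hd : d ∈ X \ Y) (he : e ∈ Y \ X) :
    (Equiv.swap d e • X) ∩ (Equiv.swap d e • Y) = X ∩ Y := by
  ext x
  simp only [Finset.mem_inter, ← Finset.inv_smul_mem_iff, Equiv.swap_inv, Equiv.Perm.smul_def]
  simp only [Finset.mem_sdiff] at hd he
  by_cases h1 : x = d
  · subst h1; simp [hd, he]
  by_cases h2 : x = e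
  · subst h2; simp [hd, he]
  rw [Equiv.swap_apply_of_ne_of_ne h1 h2]

lemma swap_union_aux {α : Type*} [DecidableEq α] (X Y : Finset α) (d e : α)
    (hd : d ∈ X \ Y) (he : e ∈ Y \ X) :
    (Equiv.swap d e • X) ∪ (Equiv.swap d e • Y) = X ∪ Y := by
  ext x
  simp only [Finset.mem_union, ← Finset.inv_smul_mem_iff, Equiv.swap_inv, Equiv.Perm.smul_def]
  simp only [Finset.mem_sdiff] at hd he
  by_cases h1 : x = d
  · subst h1; simp [hd, he]
  by_cases h2 : x = e
  · subst h2; simp [hd, he]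
  rw [Equiv.swap_apply_of_ne_of_ne h1 h2]

lemma exists_enum {α : Type*} [DecidableEq α] [Nonempty α] (A : Finset α) (r : ℕ)
    (h : A.card = r) : ∃ a : ℕ → α, Set.InjOn a (Finset.range r) ∧ (Finset.range r).image a = A := by
  subst h
  let x0 : α := Classical.arbitrary α
  refine ⟨fun i => if h : i < A.card then (A.equivFin.symm ⟨i, h⟩ : α) else x0, ?_, ?_⟩
  · intro i hi j hj hij
    simp only [Finset.coe_range, Set.mem_Iio] at hi hj
    simp only [hi, hj, dif_pos] at hij
    have := A.equivFin.symm.injective (Subtype.ext hij)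
    simpa using this
  · ext x
    simp only [Finset.mem_image, Finset.mem_range]
    constructor
    · rintro ⟨i, hi, rfl⟩
      simp [hi]
    · intro hx
      refine ⟨A.equivFin ⟨x, hx⟩, (A.equivFin ⟨x, hx⟩).2, ?_⟩
      simp

lemma exists_path {α : Type*} [DecidableEq α] [Nonempty α] (X Y : Finset α)
    (h : X.card = Y.card) : ∃ (r : ℕ) (a b : ℕ → α) (τ : ℕ → Equiv.Perm α),
      Set.InjOn a (Finset.range r) ∧ (Finset.range r).image a = X \ Y ∧
      Set.InjOn b (Finset.range r) ∧ (Finset.range r).image b = Y \ X ∧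
      τ 0 = 1 ∧ (∀ i, τ (i+1) = τ i * Equiv.swap (a i) (b i)) ∧
      (∀ i ≤ r, (τ i • X) ∩ (τ i • Y) = X ∩ Y ∧ (τ i • X) ∪ (τ i • Y) = X ∪ Y) ∧
      τ r • X = Y := by
  have hc : (Y \ X).card = (X \ Y).card := by
    have h1 := Finset.card_sdiff_add_card_inter X Y
    have h2 := Finset.card_sdiff_add_card_inter Y X
    rw [Finset.inter_comm] at h2
    omega
  obtain ⟨a, ha, ha'⟩ := exists_enum (X \ Y) _ rfl
  obtain ⟨b, hb, hb'⟩ := exists_enum (Y \ X) _ hc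
  set r := (X \ Y).card with hr
  have hma : ∀ i < r, a i ∈ X \ Y := fun i hi => by
    rw [← ha']; exact Finset.mem_image_of_mem _ (Finset.mem_range.2 hi)
  have hmb : ∀ i < r, b i ∈ Y \ X := fun i hi => by
    rw [← hb']; exact Finset.mem_image_of_mem _ (Finset.mem_range.2 hi)
  have hab : ∀ i < r, ∀ j < r, a i ≠ b j := fun i hi j hj hij => by
    have h1 := hma i hi
    have h2 := hmb j hj
    rw [hij] at h1
    simp only [Finset.mem_sdiff] at h1 h2
    exact h2.2 h1.1
  have hai : ∀ i < r, ∀ j < r, i ≠ j → a i ≠ a j := fun i hi j hj hij h =>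
    hij (ha (by simpa using hi) (by simpa using hj) h)
  have hbi : ∀ i < r, ∀ j < r, i ≠ j → b i ≠ b j := fun i hi j hj hij h =>
    hij (hb (by simpa using hi) (by simpa using hj) h)
  let τ : ℕ → Equiv.Perm α := fun n => Nat.rec 1 (fun i t => t * Equiv.swap (a i) (b i)) n
  have hτ0 : τ 0 = 1 := rfl
  have hτs : ∀ i, τ (i+1) = τ i * Equiv.swap (a i) (b i) := fun i => rfl
  refine ⟨r, a, b, τ, ha, ha', hb, hb', hτ0, hτs, ?_, ?_⟩
  · intro i
    induction i with
    | zero => intro _; simp [hτ0]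
    | succ i ih =>
      intro hi
      obtain ⟨h1, h2⟩ := ih (by omega)
      rw [← Finset.smul_finset_inter] at h1
      rw [← Finset.smul_finset_union] at h2
      rw [hτs, mul_smul, mul_smul, ← Finset.smul_finset_inter, ← Finset.smul_finset_union,
        swap_inter_aux X Y _ _ (hma i hi) (hmb i hi), swap_union_aux X Y _ _ (hma i hi) (hmb i hi)]
      exact ⟨h1, h2⟩
  · have key : ∀ i ≤ r, (∀ x, x ∉ X \ Y → x ∉ Y \ X → τ i x = x) ∧
        (∀ j < r, i ≤ j → τ i (a j) = a j ∧ τ i (b j) = b j) ∧ (∀ j < i, τ i (a j) = b j) := by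
      intro i
      induction i with
      | zero => intro _; simp [hτ0]
      | succ i ih =>
        intro hi
        obtain ⟨h1, h2, h3⟩ := ih (by omega)
        refine ⟨?_, ?_, ?_⟩
        · intro x hx hx'
          rw [hτs, Equiv.Perm.mul_apply, Equiv.swap_apply_of_ne_of_ne, h1 x hx hx']
          · rintro rfl; exact hx (hma i hi)
          · rintro rfl; exact hx' (hmb i hi)
        · intro j hj hij
          rw [hτs, Equiv.Perm.mul_apply, Equiv.Perm.mul_apply,
            Equiv.swap_apply_of_ne_of_ne (hai j hj i hi (by omega)) (hab j hj i hi),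
            Equiv.swap_apply_of_ne_of_ne (hab i hi j hj).symm (hbi j hj i hi (by omega))]
          exact h2 j hj (by omega)
        · intro j hj
          rw [hτs, Equiv.Perm.mul_apply]
          by_cases hji : j = i
          · subst hji
            rw [Equiv.swap_apply_left]
            exact (h2 j hi le_rfl).2
          · rw [Equiv.swap_apply_of_ne_of_ne (hai j (by omega) i hi hji) (hab j (by omega) i hi)]
            exact h3 j (by omega)
    obtain ⟨h1, h2, h3⟩ := key r le_rfl
    apply Finset.eq_of_subset_of_card_le
    · intro y hy
      rw [Finset.mem_smul_finset] at hy
      obtain ⟨x, hx, rfl⟩ := hy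
      rw [Equiv.Perm.smul_def]
      by_cases hxY : x ∈ Y
      · rw [h1 x (by simp [hxY]) (by simp [hx])]; exact hxY
      · have : x ∈ X \ Y := by simp [hx, hxY]
        rw [← ha'] at this
        obtain ⟨j, hj, rfl⟩ := Finset.mem_image.1 this
        have hj := Finset.mem_range.1 hj
        rw [h3 j hj]
        exact (Finset.mem_sdiff.1 (hmb j hj)).1
    · rw [Finset.card_smul_finset, h]

/-- edge functional -/
noncomputable def edgeF {α : Type*} (p f : Finset α → ℝ) (S W T W' : Finset α) : ℝ :=
  p S * p T / (p S + p T) * (p W + p W') * (f S - f T) ^ 2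

lemma pathA {α : Type*} [DecidableEq α] [Nonempty α] [Fintype α] (k : ℕ)
    (p f : Finset α → ℝ) (hp : ∀ S, 0 < p S) (M : ℝ)
    (hM : ∀ X Y Z W : Finset α, X.card = k → Y.card = k → Z.card = k → W.card = k →
      Z ∩ W = X ∩ Y → Z ∪ W = X ∪ Y → p X * p Y ≤ M * (p Z * p W))
    (X Y : Finset α) (hX : X.card = k) (hY : Y.card = k) :
    ∑ σ : Equiv.Perm α, p (σ • X) * p (σ • Y) * (f (σ • X) - f (σ • Y)) ^ 2 ≤
    M * ∑ d ∈ X \ Y, ∑ e ∈ Y \ X, ∑ σ : Equiv.Perm α,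
      edgeF p f (σ • X) (σ • Y) (σ • Equiv.swap d e • X) (σ • Equiv.swap d e • Y) := by
  obtain ⟨r, a, b, τ, ha, ha', hb, hb', h0, hs, hiu, hr⟩ := exists_path X Y (hX.trans hY.symm)
  set Ψ : Equiv.Perm α → α → α → ℝ := fun σ d e =>
    edgeF p f (σ • X) (σ • Y) (σ • Equiv.swap d e • X) (σ • Equiv.swap d e • Y) with hΨ
  have hma : ∀ i < r, a i ∈ X \ Y := fun i hi => by
    rw [← ha']; exact Finset.mem_image_of_mem _ (Finset.mem_range.2 hi)
  have hmb : ∀ i < r, b i ∈ Y \ X := fun i hi => by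
    rw [← hb']; exact Finset.mem_image_of_mem _ (Finset.mem_range.2 hi)
  have step1 : ∀ σ : Equiv.Perm α, p (σ • X) * p (σ • Y) * (f (σ • X) - f (σ • Y)) ^ 2 ≤
      M * (r * ∑ i ∈ Finset.range r, Ψ (σ * τ i) (a i) (b i)) := by
    intro σ
    have e1 : f (σ • X) - f (σ • Y) =
        ∑ i ∈ Finset.range r, (f (σ • τ i • X) - f (σ • τ (i+1) • X)) := by
      rw [Finset.sum_range_sub' (fun i => f (σ • τ i • X)), h0, hr, one_smul]
    have e2 : (f (σ • X) - f (σ • Y)) ^ 2 ≤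
        r * ∑ i ∈ Finset.range r, (f (σ • τ i • X) - f (σ • τ (i+1) • X)) ^ 2 := by
      rw [e1]
      have := sq_sum_le_card_mul_sum_sq (s := Finset.range r)
        (f := fun i => (f (σ • τ i • X) - f (σ • τ (i+1) • X)))
      simpa using this
    calc _ ≤ p (σ • X) * p (σ • Y) *
          (r * ∑ i ∈ Finset.range r, (f (σ • τ i • X) - f (σ • τ (i+1) • X)) ^ 2) :=
          mul_le_mul_of_nonneg_left e2 (mul_pos (hp _) (hp _)).le
      _ = r * ∑ i ∈ Finset.range r, p (σ • X) * p (σ • Y) *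
          (f (σ • τ i • X) - f (σ • τ (i+1) • X)) ^ 2 := by
          rw [← Finset.mul_sum]; ring
      _ ≤ r * ∑ i ∈ Finset.range r, M * Ψ (σ * τ i) (a i) (b i) := by
          apply mul_le_mul_of_nonneg_left _ (Nat.cast_nonneg r)
          apply Finset.sum_le_sum
          intro i hi
          have hi := Finset.mem_range.1 hi
          obtain ⟨i1, i2⟩ := hiu i hi.le
          obtain ⟨j1, j2⟩ := hiu (i+1) hi
          have u1 := hM (σ • X) (σ • Y) (σ • τ i • X) (σ • τ i • Y)
            (by simpa using hX) (by simpa using hY) (by simpa using hX) (by simpa using hY)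
            (by rw [← Finset.smul_finset_inter, i1, Finset.smul_finset_inter])
            (by rw [← Finset.smul_finset_union, i2, Finset.smul_finset_union])
          have u2 := hM (σ • X) (σ • Y) (σ • τ (i+1) • X) (σ • τ (i+1) • Y)
            (by simpa using hX) (by simpa using hY) (by simpa using hX) (by simpa using hY)
            (by rw [← Finset.smul_finset_inter, j1, Finset.smul_finset_inter])
            (by rw [← Finset.smul_finset_union, j2, Finset.smul_finset_union])
          simp only [hΨ, edgeF, mul_smul]
          rw [hs i] at u2 ⊢
          simp only [mul_smul] at u2 ⊢
          rw [← mul_assoc]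
          apply mul_le_mul_of_nonneg_right _ (sq_nonneg _)
          generalize p (σ • X) * p (σ • Y) = u at *
          have q1 := hp (σ • τ i • X)
          have q2 := hp (σ • τ i • Equiv.swap (a i) (b i) • X)
          generalize p (σ • τ i • X) = s at *
          generalize p (σ • τ i • Equiv.swap (a i) (b i) • X) = t at *
          rw [div_mul_eq_mul_div, mul_div_assoc', le_div_iff₀ (by positivity)]
          nlinarith [mul_le_mul_of_nonneg_left u1 q2.le, mul_le_mul_of_nonneg_left u2 q1.le]
      _ = _ := by rw [← Finset.mul_sum]; ring
  have step2 : ∀ i j, i < r → j < r →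
      ∑ σ : Equiv.Perm α, Ψ σ (a i) (b j) = ∑ σ : Equiv.Perm α, Ψ σ (a i) (b i) := by
    intro i j hi hj
    set g := Equiv.swap (b i) (b j) with hg
    have m1 := Finset.mem_sdiff.1 (hma i hi)
    have m2 := Finset.mem_sdiff.1 (hmb i hi)
    have m3 := Finset.mem_sdiff.1 (hmb j hj)
    have gX : g • X = X := by
      ext x
      rw [← Finset.inv_smul_mem_iff, hg, Equiv.swap_inv, Equiv.Perm.smul_def]
      by_cases h1 : x = b i
      · subst h1; simp [m2, m3]
      by_cases h2 : x = b j
      · subst h2; simp [m2, m3]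
      rw [Equiv.swap_apply_of_ne_of_ne h1 h2]
    have gY : g • Y = Y := by
      ext x
      rw [← Finset.inv_smul_mem_iff, hg, Equiv.swap_inv, Equiv.Perm.smul_def]
      by_cases h1 : x = b i
      · subst h1; simp [m2, m3]
      by_cases h2 : x = b j
      · subst h2; simp [m2, m3]
      rw [Equiv.swap_apply_of_ne_of_ne h1 h2]
    have gs : g * Equiv.swap (a i) (b i) = Equiv.swap (a i) (b j) * g := by
      rw [Equiv.mul_swap_eq_swap_mul, hg, Equiv.swap_apply_left, Equiv.swap_apply_of_ne_of_ne]
      · rintro h; rw [h] at m1; exact m2.2 m1.1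
      · rintro h; rw [h] at m1; exact m3.2 m1.1
    rw [← Equiv.sum_comp (Equiv.mulRight g) (fun σ => Ψ σ (a i) (b i))]
    apply Finset.sum_congr rfl
    intro σ _
    simp only [Equiv.coe_mulRight, hΨ]
    have k1 : ∀ Z : Finset α, g • Z = Z → (σ * g) • Equiv.swap (a i) (b i) • Z =
        σ • Equiv.swap (a i) (b j) • Z := by
      intro Z hZ
      rw [mul_smul, ← mul_smul g, gs, mul_smul _ g, hZ]
    rw [k1 X gX, k1 Y gY, mul_smul, mul_smul, gX, gY]
  calc _ ≤ ∑ σ : Equiv.Perm α, M * (r * ∑ i ∈ Finset.range r, Ψ (σ * τ i) (a i) (b i)) :=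
        Finset.sum_le_sum fun σ _ => step1 σ
    _ = M * (r * ∑ i ∈ Finset.range r, ∑ σ : Equiv.Perm α, Ψ (σ * τ i) (a i) (b i)) := by
        rw [← Finset.mul_sum, ← Finset.mul_sum, Finset.sum_comm]
    _ = M * (r * ∑ i ∈ Finset.range r, ∑ σ : Equiv.Perm α, Ψ σ (a i) (b i)) := by
        congr 2
        apply Finset.sum_congr rfl
        intro i _
        exact Equiv.sum_comp (Equiv.mulRight (τ i)) (fun σ => Ψ σ (a i) (b i))
    _ = M * ∑ i ∈ Finset.range r, ∑ j ∈ Finset.range r, ∑ σ : Equiv.Perm α, Ψ σ (a i) (b j) := by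
        congr 1
        rw [Finset.mul_sum]
        apply Finset.sum_congr rfl
        intro i hi
        rw [Finset.sum_congr rfl (fun j hj => step2 i j (Finset.mem_range.1 hi)
          (Finset.mem_range.1 hj))]
        simp
    _ = _ := by
        rw [← ha', ← hb', Finset.sum_image ha]
        congr 1
        apply Finset.sum_congr rfl
        intro i _
        rw [Finset.sum_image hb]

lemma sumC {α : Type*} [DecidableEq α] [Fintype α] (k : ℕ) (σ : Equiv.Perm α)
    (Ξ : Finset α → ℝ) :
    ∑ X ∈ Finset.univ.filter (fun S : Finset α => S.card = k), Ξ (σ • X) =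
    ∑ X ∈ Finset.univ.filter (fun S : Finset α => S.card = k), Ξ X := by
  apply Finset.sum_nbij' (fun X => σ • X) (fun X => σ⁻¹ • X)
  · intro X hX; simpa using hX
  · intro X hX; simpa using hX
  · intro X _; simp
  · intro X _; simp
  · intro X _; rfl

lemma sum_smul_aux {α : Type*} [DecidableEq α] (σ : Equiv.Perm α) (A : Finset α) (Ξ : α → ℝ) :
    ∑ x ∈ σ • A, Ξ x = ∑ x ∈ A, Ξ (σ x) := by
  rw [Finset.smul_finset_def, Finset.sum_image]
  · rfl
  · intro x _ y _ h; exact σ.injective h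

lemma poincareB {α : Type*} [DecidableEq α] [Nonempty α] [Fintype α] (k : ℕ)
    (p f : Finset α → ℝ) (hp : ∀ S, 0 < p S) (M : ℝ) (hM0 : 0 ≤ M)
    (hM : ∀ X Y Z W : Finset α, X.card = k → Y.card = k → Z.card = k → W.card = k →
      Z ∩ W = X ∩ Y → Z ∪ W = X ∪ Y → p X * p Y ≤ M * (p Z * p W))
    (C : Finset (Finset α)) (hC : C = Finset.univ.filter (fun S : Finset α => S.card = k))
    (h1 : ∑ S ∈ C, p S = 1) :
    ∑ X ∈ C, ∑ Y ∈ C, p X * p Y * (f X - f Y) ^ 2 ≤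
    2 * M * ∑ X ∈ C, ∑ d ∈ X, ∑ e ∈ Xᶜ, p X * p (Equiv.swap d e • X) /
      (p X + p (Equiv.swap d e • X)) * (f X - f (Equiv.swap d e • X)) ^ 2 := by
  have hmem : ∀ X ∈ C, X.card = k := fun X hX => by rw [hC] at hX; simpa using hX
  set G : Finset α → Finset α → ℝ := fun X Y => ∑ d ∈ X \ Y, ∑ e ∈ Y \ X,
    edgeF p f X Y (Equiv.swap d e • X) (Equiv.swap d e • Y) with hG
  have avg : ∀ H : Finset α → Finset α → ℝ,
      ∑ X ∈ C, ∑ Y ∈ C, ∑ σ : Equiv.Perm α, H (σ • X) (σ • Y) =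
      (Fintype.card (Equiv.Perm α) : ℝ) * ∑ X ∈ C, ∑ Y ∈ C, H X Y := by
    intro H
    have : ∀ σ : Equiv.Perm α, ∑ X ∈ C, ∑ Y ∈ C, H (σ • X) (σ • Y) =
        ∑ X ∈ C, ∑ Y ∈ C, H X Y := by
      intro σ
      rw [hC]
      rw [← sumC k σ (fun X => ∑ Y ∈ Finset.univ.filter (fun S : Finset α => S.card = k), H X Y)]
      apply Finset.sum_congr rfl
      intro X _
      rw [← sumC k σ (fun Y => H (σ • X) Y)]
    rw [Finset.sum_congr rfl (fun X _ => Finset.sum_comm), Finset.sum_comm,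
      Finset.sum_congr rfl (fun σ _ => this σ)]
    simp
  have hGs : ∀ (σ : Equiv.Perm α) X Y, G (σ • X) (σ • Y) = ∑ d ∈ X \ Y, ∑ e ∈ Y \ X,
      edgeF p f (σ • X) (σ • Y) (σ • Equiv.swap d e • X) (σ • Equiv.swap d e • Y) := by
    intro σ X Y
    simp only [hG]
    rw [← Finset.smul_finset_sdiff, ← Finset.smul_finset_sdiff, sum_smul_aux]
    apply Finset.sum_congr rfl
    intro d _
    rw [sum_smul_aux]
    apply Finset.sum_congr rfl
    intro e _
    have : ∀ Z : Finset α, Equiv.swap (σ d) (σ e) • σ • Z = σ • Equiv.swap d e • Z := by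
      intro Z
      rw [← mul_smul, ← mul_smul, Equiv.mul_swap_eq_swap_mul]
    rw [this, this]
  have main : ∑ X ∈ C, ∑ Y ∈ C, p X * p Y * (f X - f Y) ^ 2 ≤ M * ∑ X ∈ C, ∑ Y ∈ C, G X Y := by
    have hpos : (0 : ℝ) < Fintype.card (Equiv.Perm α) := by
      exact_mod_cast Fintype.card_pos
    apply le_of_mul_le_mul_left _ hpos
    rw [← avg (fun X Y => p X * p Y * (f X - f Y) ^ 2), mul_left_comm, ← avg G, Finset.mul_sum]
    apply Finset.sum_le_sum
    intro X hX
    rw [Finset.mul_sum]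
    apply Finset.sum_le_sum
    intro Y hY
    refine (pathA k p f hp M hM X Y (hmem X hX) (hmem Y hY)).trans (le_of_eq ?_)
    congr 1
    simp only [hGs]
    symm
    rw [Finset.sum_comm]
    apply Finset.sum_congr rfl
    intro d _
    rw [Finset.sum_comm]
  refine main.trans ?_
  rw [mul_comm 2 M, mul_assoc]
  apply mul_le_mul_of_nonneg_left _ hM0
  rw [Finset.mul_sum]
  apply Finset.sum_le_sum
  intro X hX
  calc ∑ Y ∈ C, G X Y ≤ ∑ Y ∈ C, ∑ d ∈ X, ∑ e ∈ Xᶜ, (p X * p (Equiv.swap d e • X) /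
        (p X + p (Equiv.swap d e • X)) * (f X - f (Equiv.swap d e • X)) ^ 2) *
        (p Y + p (Equiv.swap d e • Y)) := by
        apply Finset.sum_le_sum
        intro Y _
        simp only [hG]
        have hn : ∀ d e : α, 0 ≤ edgeF p f X Y (Equiv.swap d e • X) (Equiv.swap d e • Y) := by
          intro d e
          have := hp X
          have := hp Y
          have := hp (Equiv.swap d e • X)
          have := hp (Equiv.swap d e • Y)
          unfold edgeF
          positivity
        calc _ ≤ ∑ d ∈ X, ∑ e ∈ Y \ X,
              edgeF p f X Y (Equiv.swap d e • X) (Equiv.swap d e • Y) :=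
              Finset.sum_le_sum_of_subset_of_nonneg Finset.sdiff_subset
                (fun d _ _ => Finset.sum_nonneg fun e _ => hn d e)
          _ ≤ ∑ d ∈ X, ∑ e ∈ Xᶜ,
              edgeF p f X Y (Equiv.swap d e • X) (Equiv.swap d e • Y) := by
              apply Finset.sum_le_sum
              intro d _
              apply Finset.sum_le_sum_of_subset_of_nonneg
              · intro e he
                simp only [Finset.mem_sdiff] at he
                simp [he]
              · intro e _ _; exact hn d e
          _ = _ := by
              apply Finset.sum_congr rfl
              intro d _
              apply Finset.sum_congr rfl
              intro e _
              unfold edgeF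
              ring
    _ = _ := by
        rw [Finset.sum_comm, Finset.mul_sum]
        apply Finset.sum_congr rfl
        intro d _
        rw [Finset.sum_comm, Finset.mul_sum]
        apply Finset.sum_congr rfl
        intro e _
        rw [← Finset.mul_sum, Finset.sum_add_distrib, h1]
        have : ∑ Y ∈ C, p (Equiv.swap d e • Y) = 1 := by
          rw [← h1, hC]
          exact sumC k (Equiv.swap d e) p
        rw [this]
        ring

lemma swap_smul_eq {α : Type*} [DecidableEq α] (X : Finset α) (d e : α) (hd : d ∈ X)
    (he : e ∉ X) : Equiv.swap d e • X = insert e (X.erase d) := by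
  have hde : d ≠ e := by rintro rfl; exact he hd
  ext x
  rw [← Finset.inv_smul_mem_iff, Equiv.swap_inv, Equiv.Perm.smul_def]
  by_cases h1 : x = d
  · subst h1; simp [he, hde]
  by_cases h2 : x = e
  · subst h2; simp [hd]
  rw [Equiv.swap_apply_of_ne_of_ne h1 h2]
  simp [h1, h2]

/-- Sum over the exchanges = sum over the neighbours. -/
lemma sum_nbr {α : Type*} [DecidableEq α] [Fintype α] (k : ℕ) (X : Finset α) (hX : X.card = k)
    (h : Finset α → ℝ) :
    ∑ d ∈ X, ∑ e ∈ Xᶜ, h (Equiv.swap d e • X) =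
    ∑ T ∈ Finset.univ.filter (fun S : Finset α => S.card = k),
      if (symmDiff X T).card = 2 then h T else 0 := by
  rw [← Finset.sum_filter, ← Finset.sum_product']
  apply Finset.sum_bij (fun x _ => Equiv.swap x.1 x.2 • X)
  · rintro ⟨d, e⟩ hx
    simp only [Finset.mem_product, Finset.mem_compl] at hx
    obtain ⟨hd, he⟩ := hx
    have hde : d ≠ e := by rintro rfl; exact he hd
    simp only [Finset.mem_filter, Finset.mem_univ, true_and, Finset.card_smul_finset]
    refine ⟨hX, ?_⟩
    rw [swap_smul_eq X d e hd he]
    have : symmDiff X (insert e (X.erase d)) = {d, e} := by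
      ext x
      simp only [Finset.mem_symmDiff, Finset.mem_insert, Finset.mem_erase, Finset.mem_singleton]
      by_cases h1 : x = d
      · subst h1; simp [hd, hde]
      by_cases h2 : x = e
      · subst h2; simp [he]
      simp [h1, h2]
    rw [this, Finset.card_pair hde]
  · rintro ⟨d, e⟩ hx ⟨d', e'⟩ hx' heq
    simp only [Finset.mem_product, Finset.mem_compl] at hx hx'
    simp only at heq
    rw [swap_smul_eq X d e hx.1 hx.2, swap_smul_eq X d' e' hx'.1 hx'.2] at heq
    have h1 : e ∈ insert e' (X.erase d') := by rw [← heq]; simp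
    have h2 : d ∉ insert e' (X.erase d') := by
      rw [← heq]
      simp only [Finset.mem_insert, Finset.mem_erase]
      rintro (h | h)
      · rw [h] at hx; exact hx.2 hx.1
      · exact h.1 rfl
    simp only [Finset.mem_insert, Finset.mem_erase, hx.2, and_false, or_false] at h1
    simp only [Finset.mem_insert, Finset.mem_erase, hx.1, and_true, not_or, not_not] at h2
    rw [h1, h2.2]
  · intro T hT
    simp only [Finset.mem_filter, Finset.mem_univ, true_and] at hT
    obtain ⟨hT, hs⟩ := hT
    have hdis : Disjoint (X \ T) (T \ X) := disjoint_sdiff_sdiff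
    have hs' : (X \ T).card + (T \ X).card = 2 := by
      rw [← hs, symmDiff_def, Finset.sup_eq_union, Finset.card_union_of_disjoint hdis]
    have g1 := Finset.card_sdiff_add_card_inter X T
    have g2 := Finset.card_sdiff_add_card_inter T X
    rw [Finset.inter_comm] at g2
    obtain ⟨d, hd⟩ := Finset.card_eq_one.1 (show (X \ T).card = 1 by omega)
    obtain ⟨e, he⟩ := Finset.card_eq_one.1 (show (T \ X).card = 1 by omega)
    have hd' : d ∈ X \ T := by rw [hd]; simp
    have he' : e ∈ T \ X := by rw [he]; simp
    simp only [Finset.mem_sdiff] at hd' he'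
    refine ⟨(d, e), by simp [hd', he'], ?_⟩
    simp only
    rw [swap_smul_eq X d e hd'.1 he'.2]
    ext x
    have hdx : x ∈ X \ T ↔ x = d := by rw [hd]; simp
    have hex : x ∈ T \ X ↔ x = e := by rw [he]; simp
    simp only [Finset.mem_sdiff] at hdx hex
    simp only [Finset.mem_insert, Finset.mem_erase]
    tauto
  · intro x _; rfl

end core

lemma dirichlet_id {Ω : Type*} [Fintype Ω] (P : Matrix Ω Ω ℝ) (μ : Ω → ℝ) (hrev : ∀ x y, μ x * P x y = μ y * P y x)
    (hrow : ∀ x, ∑ y, P x y = 1) (s : ℝ) (hs : s ^ 2 = 1) (f : Ω → ℝ) :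
    ∑ x, ∑ y, μ x * P x y * (f x + s * f y) ^ 2 =
      2 * (∑ x, μ x * f x ^ 2) + 2 * s * ∑ x, μ x * f x * ∑ y, P x y * f y := by
  have e1 : ∑ x, ∑ y, μ x * P x y * f x ^ 2 = ∑ x, μ x * f x ^ 2 := by
    apply Finset.sum_congr rfl
    intro x _
    calc _ = ∑ y, P x y * (μ x * f x ^ 2) := Finset.sum_congr rfl fun y _ => by ring
      _ = _ := by rw [← Finset.sum_mul, hrow, one_mul]
  have e2 : ∑ x, ∑ y, μ x * P x y * f y ^ 2 = ∑ x, μ x * f x ^ 2 := by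
    rw [Finset.sum_comm, ← e1]
    apply Finset.sum_congr rfl
    intro x _
    apply Finset.sum_congr rfl
    intro y _
    rw [hrev]
  have e3 : ∑ x, ∑ y, μ x * P x y * (f x * f y) = ∑ x, μ x * f x * ∑ y, P x y * f y := by
    apply Finset.sum_congr rfl
    intro x _
    rw [Finset.mul_sum]
    apply Finset.sum_congr rfl
    intro y _
    ring
  calc _ = ∑ x, ∑ y, (μ x * P x y * f x ^ 2 + μ x * P x y * f y ^ 2 +
        2 * s * (μ x * P x y * (f x * f y))) := by
        apply Finset.sum_congr rfl
        intro x _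
        apply Finset.sum_congr rfl
        intro y _
        linear_combination (μ x * P x y * f y ^ 2) * hs
    _ = _ := by
        simp only [Finset.sum_add_distrib, ← Finset.mul_sum]
        rw [e1, e2]
        simp only [Finset.mul_sum] at e3 ⊢
        simp only [e3, ← Finset.mul_sum]
        simp only [← Finset.mul_sum] at e3
        ring_nf

lemma poin_mean_zero {Ω : Type*} [Fintype Ω] (μ : Ω → ℝ) (h1 : ∑ x, μ x = 1) (f : Ω → ℝ)
    (hf : ∑ x, μ x * f x = 0) :
    ∑ x, ∑ y, μ x * μ y * (f x - f y) ^ 2 = 2 * ∑ x, μ x * f x ^ 2 := by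
  have := dirichlet_id (Matrix.of fun _ y => μ y) μ (fun x y => by simp [mul_comm])
    (fun x => by simpa using h1) (-1) (by norm_num) f
  simp only [Matrix.of_apply, hf, mul_zero, Finset.sum_const_zero, add_zero] at this
  rw [← this]
  simp only [neg_mul, one_mul, sub_eq_add_neg]

lemma contraction {Ω : Type*} [Fintype Ω] [DecidableEq Ω] (P : Matrix Ω Ω ℝ) (μ : Ω → ℝ)
    (hμ : ∀ x, 0 < μ x) (h1 : ∑ x, μ x = 1)
    (hrev : ∀ x y, μ x * P x y = μ y * P y x) (hrow : ∀ x, ∑ y, P x y = 1)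
    (hP : ∀ x y, 0 ≤ P x y) (hdiag : ∀ x, 1 / 2 ≤ P x x) (ρ : ℝ) (hρ : 4 ≤ ρ)
    (hpoin : ∀ f : Ω → ℝ, ∑ x, ∑ y, μ x * μ y * (f x - f y) ^ 2 ≤
      ρ * ∑ x, ∑ y, μ x * P x y * (f x - f y) ^ 2)
    (f : Ω → ℝ) (hf : ∑ x, μ x * f x = 0) :
    (∑ x, μ x * (P.mulVec f) x = 0) ∧
    ∑ x, μ x * (P.mulVec f) x ^ 2 ≤ (1 - 1 / ρ) ^ 2 * ∑ x, μ x * f x ^ 2 := by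
  have hmv : ∀ (f : Ω → ℝ) x, P.mulVec f x = ∑ y, P x y * f y := fun f x => rfl
  have hsa : ∀ f g : Ω → ℝ, ∑ x, μ x * f x * P.mulVec g x = ∑ x, μ x * P.mulVec f x * g x := by
    intro f g
    simp only [hmv, Finset.mul_sum, Finset.sum_mul]
    rw [Finset.sum_comm]
    apply Finset.sum_congr rfl
    intro x _
    apply Finset.sum_congr rfl
    intro y _
    linear_combination f y * g x * hrev y x
  have hmean : ∑ x, μ x * (P.mulVec f) x = 0 := by
    have := hsa (fun _ => 1) f
    simp only [mul_one] at this
    rw [this]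
    simp only [hmv, mul_one, hrow]
    exact hf
  refine ⟨hmean, ?_⟩
  have psd : ∀ f : Ω → ℝ, 0 ≤ ∑ x, μ x * f x * P.mulVec f x := by
    intro f
    have h := dirichlet_id P μ hrev hrow 1 (by norm_num) f
    have h2 : 2 * ∑ x, μ x * f x ^ 2 ≤ ∑ x, ∑ y, μ x * P x y * (f x + 1 * f y) ^ 2 := by
      rw [Finset.mul_sum]
      apply Finset.sum_le_sum
      intro x _
      calc 2 * (μ x * f x ^ 2) ≤ μ x * P x x * (f x + 1 * f x) ^ 2 := by
            have := mul_nonneg (mul_nonneg (hμ x).le (sq_nonneg (f x)))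
              (sub_nonneg.2 (hdiag x))
            nlinarith
        _ ≤ _ := Finset.single_le_sum (f := fun y => μ x * P x y * (f x + 1 * f y) ^ 2)
            (fun y _ => mul_nonneg (mul_nonneg (hμ x).le (hP x y)) (sq_nonneg _))
            (Finset.mem_univ x)
    simp only [← hmv] at h
    linarith
  have gap : ∀ f : Ω → ℝ, ∑ x, μ x * f x = 0 →
      ∑ x, μ x * f x * P.mulVec f x ≤ (1 - 1 / ρ) * ∑ x, μ x * f x ^ 2 := by
    intro f hf
    have h := dirichlet_id P μ hrev hrow (-1) (by norm_num) f
    have h2 := hpoin f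
    rw [poin_mean_zero μ h1 f hf] at h2
    simp only [neg_mul, one_mul, ← sub_eq_add_neg, ← hmv] at h
    rw [h] at h2
    have h3 : (1 - 1 / ρ) * ∑ x, μ x * f x ^ 2 =
      ∑ x, μ x * f x ^ 2 - (∑ x, μ x * f x ^ 2) / ρ := by ring
    rw [h3, le_sub_comm, div_le_iff₀ (by linarith)]
    linarith
  set g := P.mulVec f with hg
  set l := 1 - 1 / ρ with hl
  have hlpos : 0 < l := by
    have : 1 / ρ ≤ 1 / 4 := one_div_le_one_div_of_le (by norm_num) hρ
    rw [hl]; linarith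
  have g1 := gap f hf
  have g2 := gap g hmean
  have q := psd (fun x => l * f x - g x)
  have e : ∑ x, μ x * (l * f x - g x) * P.mulVec (fun x => l * f x - g x) x =
      l ^ 2 * (∑ x, μ x * f x * P.mulVec f x) - 2 * l * (∑ x, μ x * g x ^ 2) +
        ∑ x, μ x * g x * P.mulVec g x := by
    have e1 : P.mulVec (fun x => l * f x - g x) = fun x => l * g x - P.mulVec g x := by
      have : (fun x => l * f x - g x) = l • f - g := by ext x; simp
      rw [this, Matrix.mulVec_sub, Matrix.mulVec_smul]
      ext x; simp [hg]
    have e2 := hsa f g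
    have e3 : ∑ x, μ x * g x ^ 2 = ∑ x, μ x * P.mulVec f x * g x := by
      apply Finset.sum_congr rfl; intro x _; rw [← hg]; ring
    rw [e1, two_mul, add_mul, sub_add_eq_sub_sub]
    nth_rewrite 1 [e3]
    rw [← e2]
    simp only [Finset.mul_sum, ← Finset.sum_sub_distrib, ← Finset.sum_add_distrib, ← hg]
    apply Finset.sum_congr rfl; intro x _; ring
  rw [e] at q
  have g1' := mul_le_mul_of_nonneg_left g1 (sq_nonneg l)
  have : l * (∑ x, μ x * g x ^ 2) ≤ l * (l ^ 2 * ∑ x, μ x * f x ^ 2) := by nlinarith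
  exact le_of_mul_le_mul_left this hlpos

lemma tv_bound {Ω : Type*} [Fintype Ω] [DecidableEq Ω] (P : Matrix Ω Ω ℝ) (μ : Ω → ℝ)
    (hμ : ∀ x, 0 < μ x) (h1 : ∑ x, μ x = 1)
    (hrev : ∀ x y, μ x * P x y = μ y * P y x) (hrow : ∀ x, ∑ y, P x y = 1)
    (hP : ∀ x y, 0 ≤ P x y) (hdiag : ∀ x, 1 / 2 ≤ P x x) (ρ : ℝ) (hρ : 4 ≤ ρ)
    (hpoin : ∀ f : Ω → ℝ, ∑ x, ∑ y, μ x * μ y * (f x - f y) ^ 2 ≤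
      ρ * ∑ x, ∑ y, μ x * P x y * (f x - f y) ^ 2) (x0 : Ω) (t : ℕ) :
    tvDist P μ x0 t ≤ (1 / 2) * ((1 - 1 / ρ) ^ t * (μ x0)⁻¹) := by
  have hl : 0 ≤ 1 - 1 / ρ := by
    have : 1 / ρ ≤ 1 / 4 := one_div_le_one_div_of_le (by norm_num) hρ
    linarith
  set f0 : Ω → ℝ := fun x => (if x = x0 then (μ x0)⁻¹ else 0) - 1 with hf0
  have hm0 : ∑ x, μ x * f0 x = 0 := by
    simp only [hf0, mul_sub, Finset.sum_sub_distrib, mul_one, h1, mul_ite, mul_zero,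
      Finset.sum_ite_eq', Finset.mem_univ, if_true]
    rw [mul_inv_cancel₀ (hμ x0).ne', sub_self]
  have hn0 : ∑ x, μ x * f0 x ^ 2 ≤ (μ x0)⁻¹ ^ 2 := by
    have : ∀ x, μ x * f0 x ^ 2 = (if x = x0 then (μ x0)⁻¹ * (1 - 2 * μ x0) else 0) + μ x := by
      intro x
      simp only [hf0]
      split_ifs with h
      · subst h
        have := (hμ x).ne'
        field_simp
        ring
      · ring
    simp only [this, Finset.sum_add_distrib, h1, Finset.sum_ite_eq', Finset.mem_univ, if_true]
    have hle : μ x0 ≤ 1 := by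
      rw [← h1]; exact Finset.single_le_sum (fun x _ => (hμ x).le) (Finset.mem_univ x0)
    have hi : 1 ≤ (μ x0)⁻¹ := (one_le_inv₀ (hμ x0)).2 hle
    have hi2 : (μ x0)⁻¹ * (1 - 2 * μ x0) = (μ x0)⁻¹ - 2 := by
      have := (hμ x0).ne'
      field_simp
    rw [hi2]
    nlinarith
  have iter : ∀ t : ℕ, (∑ x, μ x * ((P ^ t).mulVec f0) x = 0) ∧
      ∑ x, μ x * ((P ^ t).mulVec f0) x ^ 2 ≤ ((1 - 1 / ρ) ^ t * (μ x0)⁻¹) ^ 2 := by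
    intro t
    induction t with
    | zero => simpa using ⟨hm0, by simpa using hn0⟩
    | succ t ih =>
      have := contraction P μ hμ h1 hrev hrow hP hdiag ρ hρ hpoin _ ih.1
      rw [Matrix.mulVec_mulVec, ← pow_succ'] at this
      refine ⟨this.1, this.2.trans ?_⟩
      calc _ ≤ (1 - 1 / ρ) ^ 2 * ((1 - 1 / ρ) ^ t * (μ x0)⁻¹) ^ 2 :=
            mul_le_mul_of_nonneg_left ih.2 (sq_nonneg _)
        _ = _ := by ring
  have hrevt : ∀ (t : ℕ) x y, μ x * (P ^ t) x y = μ y * (P ^ t) y x := by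
    intro t
    induction t with
    | zero =>
      intro x y
      simp only [pow_zero, Matrix.one_apply]
      by_cases h : x = y
      · subst h; rfl
      · simp [h, Ne.symm h]
    | succ t ih =>
      intro x y
      rw [pow_succ, Matrix.mul_apply, ← pow_succ, pow_succ', Matrix.mul_apply, Finset.mul_sum,
        Finset.mul_sum]
      apply Finset.sum_congr rfl
      intro z _
      linear_combination P z y * ih x z + (P ^ t) z x * hrev z y
  have hrowt : ∀ (t : ℕ) x, ∑ y, (P ^ t) x y = 1 := by
    intro t
    induction t with
    | zero => intro x; simp [Matrix.one_apply]
    | succ t ih =>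
      intro x
      simp only [pow_succ', Matrix.mul_apply]
      rw [Finset.sum_comm]
      simp only [← Finset.mul_sum, ih, mul_one, hrow]
  have hid : ∀ y, (P ^ t) x0 y - μ y = μ y * ((P ^ t).mulVec f0) y := by
    intro y
    have : ((P ^ t).mulVec f0) y = (P ^ t) y x0 * (μ x0)⁻¹ - 1 := by
      simp only [Matrix.mulVec, dotProduct, hf0, mul_sub, Finset.sum_sub_distrib, mul_one,
        hrowt, mul_ite, mul_zero, Finset.sum_ite_eq', Finset.mem_univ, if_true]
    rw [this]
    have h2 := hrevt t x0 y
    have := (hμ x0).ne'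
    field_simp
    linear_combination h2
  unfold tvDist
  apply mul_le_mul_of_nonneg_left _ (by norm_num)
  apply (sq_le_sq₀ (Finset.sum_nonneg fun y _ => abs_nonneg _)
    (mul_nonneg (pow_nonneg hl t) (inv_nonneg.2 (hμ x0).le))).1
  refine le_trans ?_ (iter t).2
  have := Finset.sum_sq_le_sum_mul_sum_of_sq_eq_mul Finset.univ
    (r := fun y => |(P ^ t) x0 y - μ y|) (f := μ)
    (g := fun y => μ y * ((P ^ t).mulVec f0) y ^ 2) (fun y _ => (hμ y).le)
    (fun y _ => mul_nonneg (hμ y).le (sq_nonneg _))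
    (fun y _ => by rw [sq_abs, hid y]; ring)
  rwa [h1, one_mul] at this

/-- mixing of the lazy Gibbs exchange chain on the uniform matroid
base constraint `C = {S ⊆ [N] : |S| = k}`. -/
theorem mixing_time_exchange_chain_uniform_matroid_base
    (N k : ℕ) (hk : 0 < k) (hkN : k < N)
    (F : Finset (Fin N) → ℝ) (β : ℝ) (hβ : 0 ≤ β)
    (ZC : ℝ)
    (hZC : ZC = ∑ S ∈ Finset.univ.filter (fun S : Finset (Fin N) => S.card = k),
      Real.exp (β * F S))
    (πC : Finset (Fin N) → ℝ)
    (hπC : ∀ S : Finset (Fin N), πC S = Real.exp (β * F S) / ZC)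
    -- `ζ` is the maximum of `|F(S) + F(T) − F(S∩T) − F(S∪T)|` over `S, T ∈ C`
    (ζ : ℝ)
    (hζ : IsGreatest {r : ℝ | ∃ S T : Finset (Fin N), S.card = k ∧ T.card = k ∧
      r = |F S + F T - F (S ∩ T) - F (S ∪ T)|} ζ)
    -- the lazy Gibbs exchange chain on `C`
    (P : Matrix {S : Finset (Fin N) // S.card = k} {S : Finset (Fin N) // S.card = k} ℝ)
    (hPoff : ∀ S T : {S : Finset (Fin N) // S.card = k}, S ≠ T →
      P S T = if (symmDiff S.val T.val).card = 2 then
        (1 / (2 * (k : ℝ) * ((N : ℝ) - k))) * (πC T.val / (πC S.val + πC T.val))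
      else 0)
    (hPdiag : ∀ S : {S : Finset (Fin N) // S.card = k},
      P S S = 1 - ∑ T ∈ Finset.univ.erase S, P S T)
    (X0 : {S : Finset (Fin N) // S.card = k}) (ε : ℝ) (hε : ε ∈ Set.Ioo (0 : ℝ) 1) :
    (mixingTime P (fun S => πC S.val) X0 ε : ℝ) ≤
      4 * (k : ℝ) * ((N : ℝ) - k) * Real.exp (2 * β * ζ) *
        (Real.log (πC X0.val)⁻¹ + Real.log ε⁻¹) := by
  have hZpos : 0 < ZC := by
    rw [hZC]
    exact Finset.sum_pos (fun S _ => Real.exp_pos _) ⟨X0.val, by simp [X0.2]⟩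
  have hp : ∀ S, 0 < πC S := fun S => by rw [hπC]; exact div_pos (Real.exp_pos _) hZpos
  obtain ⟨C, hC⟩ : ∃ C, C = Finset.univ.filter (fun S : Finset (Fin N) => S.card = k) := ⟨_, rfl⟩
  rw [← hC] at hZC
  have hmemC : ∀ S, S ∈ C ↔ S.card = k := fun S => by simp [hC]
  have hsub : ∀ g : Finset (Fin N) → ℝ, ∑ S ∈ C, g S =
      ∑ S : {S : Finset (Fin N) // S.card = k}, g S.val :=
    fun g => Finset.sum_subtype C hmemC g
  have hsum : ∑ S ∈ C, πC S = 1 := by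
    simp only [hπC]
    rw [← Finset.sum_div, ← hZC, div_self hZpos.ne']
  have hsum' : ∑ S : {S : Finset (Fin N) // S.card = k}, πC S.val = 1 := by rw [← hsub, hsum]
  have hζ0 : 0 ≤ ζ := by
    obtain ⟨S, T, _, _, h⟩ := hζ.1
    rw [h]; exact abs_nonneg _
  obtain ⟨M, hMdef⟩ : ∃ M, M = Real.exp (2 * β * ζ) := ⟨_, rfl⟩
  have hM1 : 1 ≤ M := by rw [hMdef]; exact Real.one_le_exp (by positivity)
  have hM : ∀ X Y Z W : Finset (Fin N), X.card = k → Y.card = k → Z.card = k → W.card = k →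
      Z ∩ W = X ∩ Y → Z ∪ W = X ∪ Y → πC X * πC Y ≤ M * (πC Z * πC W) := by
    intro X Y Z W hX hY hZ hW hi hu
    have b1 := hζ.2 ⟨X, Y, hX, hY, rfl⟩
    have b2 := hζ.2 ⟨Z, W, hZ, hW, rfl⟩
    rw [hi, hu] at b2
    have b3 : F X + F Y ≤ 2 * ζ + (F Z + F W) := by
      have := (abs_le.1 b1).2
      have := (abs_le.1 b2).1
      linarith
    have b4 : β * F X + β * F Y ≤ 2 * β * ζ + (β * F Z + β * F W) := by
      have := mul_le_mul_of_nonneg_left b3 hβ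
      linarith
    have b5 := Real.exp_le_exp.2 b4
    rw [Real.exp_add, Real.exp_add, Real.exp_add, ← hMdef] at b5
    rw [hπC, hπC, hπC, hπC, div_mul_div_comm, div_mul_div_comm, mul_div_assoc']
    exact div_le_div_of_nonneg_right b5 (by positivity)
  have hk' : (1 : ℝ) ≤ k := by exact_mod_cast hk
  have hNk : (1 : ℝ) ≤ (N : ℝ) - k := by
    have : (k : ℝ) + 1 ≤ N := by exact_mod_cast hkN
    linarith
  have hkk : (1 : ℝ) ≤ k * ((N : ℝ) - k) := one_le_mul_of_one_le_of_one_le hk' hNk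
  obtain ⟨c, hc⟩ : ∃ c : ℝ, c = 1 / (2 * (k : ℝ) * ((N : ℝ) - k)) := ⟨_, rfl⟩
  have hcpos : 0 < c := by rw [hc]; apply one_div_pos.2; nlinarith
  have hck : (k : ℝ) * ((N : ℝ) - k) * c = 1 / 2 := by
    have : (k : ℝ) ≠ 0 := by linarith
    have : (N : ℝ) - k ≠ 0 := by linarith
    rw [hc]; field_simp
  have hPoff' : ∀ S T : {S : Finset (Fin N) // S.card = k}, S ≠ T →
      P S T = if (symmDiff S.val T.val).card = 2 then
        c * (πC T.val / (πC S.val + πC T.val)) else 0 := by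
    intro S T hST
    rw [hPoff S T hST, hc]
  have hoff0 : ∀ S T : {S : Finset (Fin N) // S.card = k}, S ≠ T → 0 ≤ P S T := by
    intro S T hST
    rw [hPoff' S T hST]
    have := hp S.val
    have := hp T.val
    split_ifs <;> positivity
  have hrow : ∀ S, ∑ T, P S T = 1 := by
    intro S
    rw [← Finset.add_sum_erase _ _ (Finset.mem_univ S), hPdiag S]
    ring
  have hrev : ∀ S T, πC S.val * P S T = πC T.val * P T S := by
    intro S T
    by_cases h : S = T
    · rw [h]
    · rw [hPoff' S T h, hPoff' T S (Ne.symm h), symmDiff_comm T.val S.val,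
        add_comm (πC T.val) (πC S.val)]
      split_ifs <;> ring
  have hcardc : ∀ S : Finset (Fin N), S.card = k → ((Sᶜ.card : ℕ) : ℝ) = (N : ℝ) - k := by
    intro S hS
    rw [Finset.card_compl, Fintype.card_fin, hS, Nat.cast_sub hkN.le]
  have hdiag : ∀ S, 1 / 2 ≤ P S S := by
    intro S
    have e1 : ∑ T ∈ Finset.univ.erase S, P S T ≤ 1 / 2 := by
      calc ∑ T ∈ Finset.univ.erase S, P S T ≤
          ∑ T ∈ Finset.univ.erase S, if (symmDiff S.val T.val).card = 2 then c else 0 := by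
            apply Finset.sum_le_sum
            intro T hT
            rw [hPoff' S T (Ne.symm (Finset.ne_of_mem_erase hT))]
            split_ifs
            · have h1 := hp S.val
              have h2 := hp T.val
              have : πC T.val / (πC S.val + πC T.val) ≤ 1 := by
                rw [div_le_one (by positivity)]; linarith
              nlinarith
            · exact le_rfl
        _ ≤ ∑ T : {S : Finset (Fin N) // S.card = k},
              if (symmDiff S.val T.val).card = 2 then c else 0 := by
            apply Finset.sum_le_sum_of_subset_of_nonneg (Finset.subset_univ _)
            intro T _ _
            split_ifs
            · exact hcpos.le
            · exact le_rfl
        _ = ∑ d ∈ S.val, ∑ e ∈ S.valᶜ, c := by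
            rw [sum_nbr k S.val S.2 (fun _ => c), ← hC,
              hsub (fun T => if (symmDiff S.val T).card = 2 then c else 0)]
        _ = 1 / 2 := by
            rw [Finset.sum_const, Finset.sum_const, nsmul_eq_mul, nsmul_eq_mul, S.2,
              hcardc S.val S.2, ← hck]
            ring
    rw [hPdiag S]
    linarith
  have hP0 : ∀ S T, 0 ≤ P S T := by
    intro S T
    by_cases h : S = T
    · rw [h]; linarith [hdiag T]
    · exact hoff0 S T h
  obtain ⟨ρ, hρdef⟩ : ∃ ρ, ρ = 4 * (k : ℝ) * ((N : ℝ) - k) * M := ⟨_, rfl⟩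
  have hρ : 4 ≤ ρ := by rw [hρdef]; nlinarith
  have hρc : ρ * c = 2 * M := by
    rw [hρdef]; linear_combination 4 * M * hck
  haveI : Nonempty (Fin N) := ⟨⟨0, by omega⟩⟩
  have hpoin : ∀ f : {S : Finset (Fin N) // S.card = k} → ℝ,
      ∑ S, ∑ T, πC S.val * πC T.val * (f S - f T) ^ 2 ≤
      ρ * ∑ S, ∑ T, πC S.val * P S T * (f S - f T) ^ 2 := by
    intro f
    obtain ⟨f', hf'⟩ : ∃ f' : Finset (Fin N) → ℝ,
        ∀ S : {S : Finset (Fin N) // S.card = k}, f' S.val = f S :=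
      ⟨fun S => if h : S.card = k then f ⟨S, h⟩ else 0, fun S => by simp [S.2]⟩
    have B := poincareB k πC f' hp M (by linarith) hM C hC hsum
    rw [hsub] at B
    simp only [hsub, hf'] at B
    refine B.trans (le_of_eq ?_)
    rw [← hρc, mul_assoc]
    congr 1
    rw [Finset.mul_sum]
    apply Finset.sum_congr rfl
    intro S _
    have nb := sum_nbr k S.val S.2 (fun T => πC S.val * πC T /
      (πC S.val + πC T) * (f S - f' T) ^ 2)
    rw [nb, ← hC, hsub (fun T => if (symmDiff S.val T).card = 2 then πC S.val * πC T /
      (πC S.val + πC T) * (f S - f' T) ^ 2 else 0), Finset.mul_sum]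
    apply Finset.sum_congr rfl
    intro T _
    simp only [hf']
    by_cases h : S = T
    · subst h; simp
    · rw [hPoff' S T h]
      split_ifs <;> ring
  have tv := tv_bound P (fun S => πC S.val) (fun S => hp S.val) hsum' hrev hrow hP0 hdiag ρ hρ
    hpoin X0
  obtain ⟨hε0, hε1⟩ := hε
  have hX0 := hp X0.val
  have hX01 : πC X0.val ≤ 1 := by
    rw [← hsum']
    exact Finset.single_le_sum (f := fun S : {S : Finset (Fin N) // S.card = k} => πC S.val)
      (fun S _ => (hp S.val).le) (Finset.mem_univ X0)
  rw [← hMdef, ← hρdef]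
  obtain ⟨B, hB⟩ : ∃ B, B = ρ * (Real.log (πC X0.val)⁻¹ + Real.log ε⁻¹) := ⟨_, rfl⟩
  rw [← hB]
  have hB0 : 0 ≤ B := by
    rw [hB]
    apply mul_nonneg (by linarith)
    apply add_nonneg
    · exact Real.log_nonneg ((one_le_inv₀ hX0).2 hX01)
    · exact Real.log_nonneg ((one_le_inv₀ hε0).2 hε1.le)
  have hmix : mixingTime P (fun S => πC S.val) X0 ε ≤ ⌊B⌋₊ := by
    apply Nat.sInf_le
    intro t' ht'
    refine (tv t').trans ?_
    have hρ0 : 0 < ρ := by linarith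
    have ht : B - 1 ≤ t' := by
      have h1 := Nat.lt_floor_add_one B
      have h2 : ((⌊B⌋₊ : ℕ) : ℝ) ≤ t' := by exact_mod_cast ht'
      linarith
    have hl : 0 ≤ 1 - 1 / ρ := by
      have : 1 / ρ ≤ 1 / 4 := one_div_le_one_div_of_le (by norm_num) hρ
      linarith
    have e1 : (1 - 1 / ρ) ^ t' ≤ Real.exp (-(t' / ρ)) := by
      calc (1 - 1 / ρ) ^ t' ≤ Real.exp (-(1 / ρ)) ^ t' :=
            pow_le_pow_left₀ hl (Real.one_sub_le_exp_neg _) _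
        _ = _ := by rw [← Real.exp_nat_mul]; congr 1; ring
    have e2 : Real.exp (-(t' / ρ)) ≤ πC X0.val * ε * 2 := by
      have : -(t' / ρ) ≤ Real.log (πC X0.val) + Real.log ε + Real.log 2 := by
        have h1 : (B - 1) / ρ ≤ t' / ρ := div_le_div_of_nonneg_right ht hρ0.le
        have h2 : (B - 1) / ρ = Real.log (πC X0.val)⁻¹ + Real.log ε⁻¹ - 1 / ρ := by
          rw [hB]; field_simp
        rw [h2, Real.log_inv, Real.log_inv] at h1
        have h3 : 1 / ρ ≤ 1 / 4 := one_div_le_one_div_of_le (by norm_num) hρ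
        have h4 := Real.log_two_gt_d9
        linarith
      refine (Real.exp_le_exp.2 this).trans (le_of_eq ?_)
      rw [Real.exp_add, Real.exp_add, Real.exp_log hX0, Real.exp_log hε0,
        Real.exp_log (by norm_num)]
    calc 1 / 2 * ((1 - 1 / ρ) ^ t' * (πC X0.val)⁻¹) ≤
        1 / 2 * ((πC X0.val * ε * 2) * (πC X0.val)⁻¹) := by
          apply mul_le_mul_of_nonneg_left _ (by norm_num)
          exact mul_le_mul_of_nonneg_right (e1.trans e2) (inv_nonneg.2 hX0.le)
      _ = ε := by field_simp
  exact le_trans (by exact_mod_cast hmix) (Nat.floor_le hB0)
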